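/- arXiv:1203.0922 — 2 statements merged into one kernel-verified Lean document; each statement's English description precedes it below -/
import Mathlib

section
/- For every n ≥ 1, the identity (n+1)·Σ t^{des(w)}(1+t)^{n−1−2·des(w)} = Σ_{k=0}^{n−1} C(n−1,k)·Σ_{w ∈ [n+1]^{n−k}} t^{des(w)+k} holds in ℤ[t], where the left-hand sum is over all parking functions w of length n that have no double descent and satisfy w_{n−1} ≤ w_n (this last condition being vacuous when n = 1). This is the combinatorial identity underlying the formula for the top Betti number of (NC_{n+1} ∗ T_{t,n})^− in terms of words over [n+1]. -/
attribute [local instance] Classical.propDecidable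

open Polynomial

/-- The number of descents of the word `w = w₁ ⋯ w_m`:
indices `i ∈ [m-1]` with `w_i > w_{i+1}`. -/
noncomputable def desF {m : ℕ} (w : Fin m → ℕ) : ℕ :=
  (Finset.univ.filter fun i : Fin (m - 1) =>
      w ⟨(i : ℕ) + 1, by have := i.2; omega⟩ < w ⟨(i : ℕ), by have := i.2; omega⟩).card

/-- The word `w = w₁ ⋯ w_m` has no double descent (no `i` with `w_i > w_{i+1} > w_{i+2}`). -/
def NDDF {m : ℕ} (w : Fin m → ℕ) : Prop :=
  ∀ i : ℕ, ∀ h : i + 2 < m,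
    ¬(w ⟨i + 1, by omega⟩ < w ⟨i, by omega⟩ ∧ w ⟨i + 2, h⟩ < w ⟨i + 1, by omega⟩)

/-- `w ∈ ℙ^n` is a parking function of length `n`: its weakly increasing rearrangement
`u = w ∘ σ` satisfies `u_i ≤ i` for all `i ∈ [n]` (positions 1-indexed). -/
def IsParkingFn {n : ℕ} (w : Fin n → ℕ) : Prop :=
  (∀ i, 1 ≤ w i) ∧
    ∃ σ : Equiv.Perm (Fin n), Monotone (w ∘ σ) ∧ ∀ i : Fin n, w (σ i) ≤ (i : ℕ) + 1

/-- The (finite) set of all parking functions of length `n` (every parking function of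
length `n` has all its letters in `[n]`). -/
noncomputable def pfFinset (n : ℕ) : Finset (Fin n → ℕ) :=
  (Fintype.piFinset fun _ : Fin n => Finset.Icc 1 n).filter IsParkingFn


open Finset in
theorem alg_y {R : Type*} [CommRing R] (z a d : R) (m : ℕ) (y : ℕ → R)
    (hy : ∀ i, 1 ≤ i → i ≤ m → y i = 1 + z * (a + d) * ∑ j ∈ Ico i (m+1), y j
      + z^2 * (a * d) * ∑ j ∈ Ico 1 i, ∑ k ∈ Ico j (m+1), y k) :
    (1 - z*a)^m * (1 + z * a * ∑ j ∈ Ico 1 (m+1), y j) =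
      1 + z^2 * (a * d) * ∑ j ∈ Ico 1 (m+1), ∑ k ∈ Ico j (m+1), y k := by
  have key : ∀ i, i ≤ m → (1 - z*a)^i * (1 + z * a * ∑ j ∈ Ico 1 (m+1), y j) =
      (1 + z * (a + d) * ∑ j ∈ Ico (i+1) (m+1), y j
      + z^2 * (a * d) * ∑ j ∈ Ico 1 (i+1), ∑ k ∈ Ico j (m+1), y k)
        - z * d * ∑ j ∈ Ico (i+1) (m+1), y j := by
    intro i
    induction i with
    | zero => intro _; simp; ring
    | succ i ih =>
      intro hi
      rw [pow_succ, mul_right_comm, ih (by omega)]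
      have h1 := hy (i+1) (by omega) hi
      rw [Finset.sum_Ico_succ_top (b := i+1) (by omega)]
      have h2 : ∑ j ∈ Ico (i+1) (m+1), y j = y (i+1) + ∑ j ∈ Ico (i+1+1) (m+1), y j :=
        Finset.sum_eq_sum_Ico_succ_bot (by omega) _
      rw [h2] at h1 ⊢
      generalize ∑ j ∈ Ico (i+1+1) (m+1), y j = T at *
      generalize ∑ j ∈ Ico 1 (i+1), ∑ k ∈ Ico j (m+1), y k = U at *
      linear_combination (z*a) * h1
  have := key m le_rfl
  simpa using this

open Finset in
theorem alg_x {R : Type*} [CommRing R] (z a d : R) (m : ℕ) (x : ℕ → R)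
    (hx : ∀ i, 1 ≤ i → i ≤ m → x i = 1 + z * a * ∑ j ∈ Ico i (m+1), x j
      + z * d * ∑ j ∈ Ico 1 (i+1), x j) :
    (1 - z*a)^m * (1 + z * a * ∑ j ∈ Ico 1 (m+1), x j) =
      (1 - z*d)^m * (1 + z * d * ∑ j ∈ Ico 1 (m+1), x j) := by
  have key : ∀ i, i ≤ m → (1 - z*a)^i * (1 + z * a * ∑ j ∈ Ico 1 (m+1), x j) =
      (1 - z*d)^i * (1 + z * a * ∑ j ∈ Ico (i+1) (m+1), x j
      + z * d * ∑ j ∈ Ico 1 (i+1), x j) := by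
    intro i
    induction i with
    | zero => intro _; simp
    | succ i ih =>
      intro hi
      rw [pow_succ, mul_right_comm, ih (by omega), pow_succ, mul_assoc, mul_assoc (_ ^ i)]
      congr 1
      have h1 := hx (i+1) (by omega) hi
      rw [Finset.sum_Ico_succ_top (b := i+1) (by omega)] at h1 ⊢
      have h2 : ∑ j ∈ Ico (i+1) (m+1), x j = x (i+1) + ∑ j ∈ Ico (i+1+1) (m+1), x j :=
        Finset.sum_eq_sum_Ico_succ_bot (by omega) _
      rw [h2] at h1 ⊢
      generalize ∑ j ∈ Ico (i+1+1) (m+1), x j = T at *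
      generalize ∑ j ∈ Ico 1 (i+1), x j = U at *
      linear_combination (z*a-z*d) * h1
  have := key m le_rfl
  simpa using this

open Finset in
theorem alg_xy (m : ℕ) (x y : ℕ → PowerSeries (Polynomial ℤ))
    (hx : ∀ i, 1 ≤ i → i ≤ m → x i = 1 + PowerSeries.X * 1 * ∑ j ∈ Ico i (m+1), x j
      + PowerSeries.X * (PowerSeries.C (X : Polynomial ℤ)) * ∑ j ∈ Ico 1 (i+1), x j)
    (hy : ∀ i, 1 ≤ i → i ≤ m → y i = 1
      + PowerSeries.X * (1 + PowerSeries.C (X : Polynomial ℤ)) * ∑ j ∈ Ico i (m+1), y j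
      + PowerSeries.X^2 * (1 * PowerSeries.C (X : Polynomial ℤ)) *
        ∑ j ∈ Ico 1 i, ∑ k ∈ Ico j (m+1), y k) :
    ∑ j ∈ Ico 1 (m+1), x j = ∑ j ∈ Ico 1 (m+1), y j := by
  have hX := alg_x _ _ _ m x hx
  have h1 := alg_y _ _ _ m y hy
  have h2 := alg_y PowerSeries.X (PowerSeries.C (X : Polynomial ℤ)) 1 m y (by
    intro i h h'; rw [add_comm _ (1 : PowerSeries (Polynomial ℤ)), mul_comm _ (1 : PowerSeries (Polynomial ℤ))]
    exact hy i h h')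
  rw [mul_comm _ (1 : PowerSeries (Polynomial ℤ)), ← h1] at h2
  set t := PowerSeries.C (X : Polynomial ℤ) with ht
  set z : PowerSeries (Polynomial ℤ) := PowerSeries.X with hz
  have hne : (1 - z*1)^m * 1 - (1 - z*t)^m * t ≠ 0 := by
    intro h
    have := congrArg (PowerSeries.constantCoeff) h
    simp [hz, ht, sub_eq_zero] at this
    exact absurd (congrArg (Polynomial.eval 0) this) (by simp)
  have hz0 : z ≠ 0 := PowerSeries.X_ne_zero
  have : (z * ((1 - z*1)^m * 1 - (1 - z*t)^m * t)) * (∑ j ∈ Ico 1 (m+1), x j) =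
     (z * ((1 - z*1)^m * 1 - (1 - z*t)^m * t)) * (∑ j ∈ Ico 1 (m+1), y j) := by
    linear_combination hX + h2
  exact mul_left_cancel₀ (mul_ne_zero hz0 hne) this

def GoodF {n : ℕ} (w : Fin (n+1) → ℕ) : Prop :=
  NDDF w ∧ w ⟨n + 1 - 2, by omega⟩ ≤ w ⟨n + 1 - 1, by omega⟩

noncomputable def Gw {n : ℕ} (w : Fin (n+1) → ℕ) : Polynomial ℤ :=
  if GoodF w then (X : Polynomial ℤ) ^ desF w * (X + 1) ^ (n + 1 - 1 - 2 * desF w) else 0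

theorem desF_one (w : Fin 1 → ℕ) : desF w = 0 := by
  unfold desF
  simp

theorem desF_cons {n : ℕ} (a : ℕ) (v : Fin (n+1) → ℕ) :
    desF (Fin.cons a v : Fin (n+2) → ℕ) = (if v 0 < a then 1 else 0) + desF v := by
  unfold desF
  rw [Finset.card_filter, Finset.card_filter]
  exact Fin.sum_univ_succ (n := n) (fun i : Fin (n+1) =>
    if (Fin.cons a v : Fin (n+2) → ℕ) ⟨i+1, by have := i.2; omega⟩ <
      (Fin.cons a v : Fin (n+2) → ℕ) ⟨i, by have := i.2; omega⟩ then 1 else 0)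

theorem cons_mk_succ {n : ℕ} (a : ℕ) (v : Fin n → ℕ) (i : ℕ) (h : i + 1 < n + 1) :
    (Fin.cons a v : Fin (n+1) → ℕ) ⟨i+1, h⟩ = v ⟨i, by omega⟩ := rfl

theorem cons_mk_zero {n : ℕ} (a : ℕ) (v : Fin n → ℕ) (h : 0 < n + 1) :
    (Fin.cons a v : Fin (n+1) → ℕ) ⟨0, h⟩ = a := rfl

theorem good_one (w : Fin 1 → ℕ) : GoodF w := by
  refine ⟨fun i h => by omega, le_refl _⟩

theorem good_asc {n : ℕ} (a : ℕ) (v : Fin (n+1) → ℕ) (h : a ≤ v 0) :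
    GoodF (Fin.cons a v : Fin (n+2) → ℕ) ↔ GoodF v := by
  unfold GoodF
  have h1 : NDDF (Fin.cons a v : Fin (n+2) → ℕ) ↔ NDDF v := by
    constructor
    · intro H i hi
      have := H (i+1) (by omega)
      simpa only [cons_mk_succ] using this
    · intro H i hi
      rcases i with _ | i
      · rw [cons_mk_succ, cons_mk_zero]
        rintro ⟨h1, -⟩
        exact absurd h1 (not_lt.2 h)
      · simpa only [cons_mk_succ] using H i (by omega)
  rw [h1]
  refine and_congr_right fun _ => ?_
  rcases n with _ | n
  · constructor
    · intro _; exact le_refl _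
    · intro _; exact h
  · rfl

theorem not_good_two (a : ℕ) (v : Fin 1 → ℕ) (h : v 0 < a) :
    ¬ GoodF (Fin.cons a v : Fin 2 → ℕ) := by
  rintro ⟨-, h2⟩
  exact absurd h (not_lt.2 h2)

theorem good_desc {n : ℕ} (a b : ℕ) (v : Fin (n+1) → ℕ) (h : b < a) :
    GoodF (Fin.cons a (Fin.cons b v : Fin (n+2) → ℕ) : Fin (n+3) → ℕ) ↔ b ≤ v 0 ∧ GoodF v := by
  by_cases hb : b ≤ v 0
  · rw [← good_asc b v hb]
    simp only [hb, true_and]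
    unfold GoodF
    refine and_congr ?_ Iff.rfl
    constructor
    · intro H i hi
      have := H (i+1) (by omega)
      simpa only [cons_mk_succ] using this
    · intro H i hi
      rcases i with _ | i
      · rintro ⟨-, h2⟩
        exact absurd h2 (not_lt.2 hb)
      · exact H i (by omega)
  · simp only [hb, false_and, iff_false]
    rintro ⟨H, -⟩
    exact H 0 (by omega) ⟨by exact h, by exact not_le.1 hb⟩

theorem good_des_le : ∀ (n : ℕ) (w : Fin (n+1) → ℕ), GoodF w → 2 * desF w ≤ n := by
  intro n
  induction n using Nat.strong_induction_on with
  | _ n ih =>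
    intro w hw
    rcases n with _ | n
    · simp [desF_one]
    · obtain ⟨a, v, rfl⟩ : ∃ a v, w = (Fin.cons a v : Fin (n+2) → ℕ) :=
        ⟨w 0, Fin.tail w, (Fin.cons_self_tail w).symm⟩
      rw [desF_cons]
      by_cases h : v 0 < a
      · rcases n with _ | n
        · exact absurd hw (not_good_two a v h)
        · obtain ⟨b, v, rfl⟩ : ∃ a v', v = (Fin.cons a v' : Fin (n+2) → ℕ) :=
            ⟨v 0, Fin.tail v, (Fin.cons_self_tail v).symm⟩
          have h' : b < a := h
          rw [good_desc a b v h'] at hw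
          have := ih n (by omega) v hw.2
          rw [desF_cons, if_neg (not_lt.2 hw.1), if_pos h]
          omega
      · rw [good_asc a v (not_lt.1 h)] at hw
        have := ih n (by omega) v hw
        rw [if_neg h]; omega

theorem Gw_one (w : Fin 1 → ℕ) : Gw w = 1 := by
  unfold Gw
  rw [if_pos (good_one w)]; simp [desF_one]

theorem Gw_asc {n : ℕ} (a : ℕ) (v : Fin (n+1) → ℕ) (h : a ≤ v 0) :
    Gw (Fin.cons a v : Fin (n+2) → ℕ) = (1 + X) * Gw v := by
  unfold Gw
  rw [good_asc a v h, desF_cons, if_neg (not_lt.2 h)]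
  split_ifs with hg
  · have := good_des_le _ _ hg
    rw [show n + 1 + 1 - 1 - 2 * (0 + desF v) = (n + 1 - 1 - 2 * desF v) + 1 by omega]
    rw [pow_succ]; simp only [zero_add]; ring
  · simp

theorem Gw_desc {n : ℕ} (a b : ℕ) (v : Fin (n+1) → ℕ) (h : b < a) :
    Gw (Fin.cons a (Fin.cons b v : Fin (n+2) → ℕ) : Fin (n+3) → ℕ) =
      if b ≤ v 0 then X * Gw v else 0 := by
  unfold Gw
  rw [good_desc a b v h, desF_cons, desF_cons]
  by_cases hb : b ≤ v 0
  · by_cases hg : GoodF v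
    · have := good_des_le _ _ hg
      rw [if_pos ⟨hb, hg⟩, if_pos hb, if_pos hg, if_neg (not_lt.2 hb), if_pos (by exact h)]
      rw [show n + 2 + 1 - 1 - 2 * (1 + (0 + desF v)) = (n + 1 - 1 - 2 * desF v) by omega]
      rw [zero_add, pow_add]; ring
    · simp [hg]
  · simp [hb]

theorem Gw_two_desc (a : ℕ) (v : Fin 1 → ℕ) (h : v 0 < a) :
    Gw (Fin.cons a v : Fin 2 → ℕ) = 0 := by
  unfold Gw
  rw [if_neg (not_good_two a v h)]

theorem sum_words_cons {R : Type*} [AddCommMonoid R] (k : ℕ) (S : Finset ℕ)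
    (f : (Fin (k+1) → ℕ) → R) :
    ∑ w ∈ Fintype.piFinset (fun _ : Fin (k+1) => S), f w =
      ∑ a ∈ S, ∑ v ∈ Fintype.piFinset (fun _ : Fin k => S), f (Fin.cons a v) := by
  rw [← Finset.sum_product']
  refine Finset.sum_bij' (fun w _ => (w 0, Fin.tail w)) (fun p _ => Fin.cons p.1 p.2) ?_ ?_ ?_ ?_ ?_
  · intro w hw
    simp only [Fintype.mem_piFinset, Finset.mem_product] at hw ⊢
    exact ⟨hw 0, fun i => hw i.succ⟩
  · intro p hp
    simp only [Fintype.mem_piFinset, Finset.mem_product] at hp ⊢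
    intro i
    refine Fin.cases ?_ ?_ i
    · exact hp.1
    · intro i; exact hp.2 i
  · intro w _; exact Fin.cons_self_tail w
  · intro p _; rfl
  · intro w _; rw [Fin.cons_self_tail]

theorem sum_words_zero {R : Type*} [AddCommMonoid R] (S : Finset ℕ)
    (f : (Fin 0 → ℕ) → R) :
    ∑ w ∈ Fintype.piFinset (fun _ : Fin 0 => S), f w = f Fin.elim0 := by
  rw [Finset.sum_eq_single Fin.elim0]
  · intro b _ hb; exact absurd (Subsingleton.elim _ _) hb
  · intro h; exact absurd (Fintype.mem_piFinset.2 fun i => i.elim0) h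

noncomputable def Yw (m n a : ℕ) : Polynomial ℤ :=
  ∑ v ∈ Fintype.piFinset (fun _ : Fin n => Finset.Icc 1 m), Gw (Fin.cons a v : Fin (n+1) → ℕ)

theorem Yw_zero (m a : ℕ) : Yw m 0 a = 1 := by
  unfold Yw
  rw [sum_words_zero, Gw_one]

theorem filter_ge (m a : ℕ) (ha : 1 ≤ a) :
    (Finset.Icc 1 m).filter (fun b => a ≤ b) = Finset.Ico a (m+1) := by
  ext b; simp; omega

theorem filter_lt (m a : ℕ) (ha : a ≤ m) :
    (Finset.Icc 1 m).filter (fun b => ¬ a ≤ b) = Finset.Ico 1 a := by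
  ext b; simp; omega

theorem Yw_one (m a : ℕ) (ha : 1 ≤ a) :
    Yw m 1 a = (1 + X) * ∑ b ∈ Finset.Ico a (m+1), Yw m 0 b := by
  rw [Yw, sum_words_cons, ← filter_ge m a ha, Finset.sum_filter, Finset.mul_sum]
  refine Finset.sum_congr rfl fun b _ => ?_
  rw [sum_words_zero]
  split_ifs with h
  · rw [Gw_asc _ _ (by exact h), Gw_one, Yw_zero]
  · rw [Gw_two_desc _ _ (by simpa using h), mul_zero]

theorem Yw_add_two (m n a : ℕ) (ha : 1 ≤ a) (ha' : a ≤ m) :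
    Yw m (n+2) a = (1 + X) * ∑ b ∈ Finset.Ico a (m+1), Yw m (n+1) b
      + X * ∑ b ∈ Finset.Ico 1 a, ∑ c ∈ Finset.Ico b (m+1), Yw m n c := by
  rw [Yw, sum_words_cons, ← Finset.sum_filter_add_sum_filter_not _ (fun b => a ≤ b),
    filter_ge m a ha, filter_lt m a ha']
  congr 1
  · rw [Finset.mul_sum]
    refine Finset.sum_congr rfl fun b hb => ?_
    rw [Yw, Finset.mul_sum]
    refine Finset.sum_congr rfl fun v _ => ?_
    rw [Gw_asc]
    exact (Finset.mem_Ico.1 hb).1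
  · rw [Finset.mul_sum]
    refine Finset.sum_congr rfl fun b hb => ?_
    rw [Finset.mem_Ico] at hb
    rw [sum_words_cons, ← filter_ge m b hb.1, Finset.sum_filter, Finset.mul_sum]
    refine Finset.sum_congr rfl fun c _ => ?_
    by_cases h : b ≤ c
    · rw [if_pos h, Yw, Finset.mul_sum]
      refine Finset.sum_congr rfl fun v _ => ?_
      rw [Gw_desc _ _ _ hb.2, if_pos (by exact h)]
    · rw [if_neg h, mul_zero]
      refine Finset.sum_eq_zero fun v _ => ?_
      rw [Gw_desc _ _ _ hb.2, if_neg (by exact h)]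

/-- descent-weighted words -/
noncomputable def Aw (m n a : ℕ) : Polynomial ℤ :=
  ∑ v ∈ Fintype.piFinset (fun _ : Fin n => Finset.Icc 1 m),
    (X : Polynomial ℤ) ^ desF (Fin.cons a v : Fin (n+1) → ℕ)

noncomputable def Bop (m : ℕ) : Module.End (Polynomial ℤ) (ℕ → Polynomial ℤ) where
  toFun f a := ∑ b ∈ Finset.Icc 1 m, (if b < a then X else 1) * f b
  map_add' f g := by
    ext1 a; simp [mul_add, Finset.sum_add_distrib]
  map_smul' c f := by
    ext1 a
    simp only [Pi.smul_apply, smul_eq_mul, RingHom.id_apply, Finset.mul_sum]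
    exact Finset.sum_congr rfl fun b _ => by ring

theorem Bop_apply (m : ℕ) (f : ℕ → Polynomial ℤ) (a : ℕ) :
    Bop m f a = ∑ b ∈ Finset.Icc 1 m, (if b < a then X else 1) * f b := rfl

theorem Aw_eq (m n : ℕ) : Aw m n = ((Bop m) ^ n) (fun _ => 1) := by
  induction n with
  | zero =>
    ext1 a
    rw [Aw, sum_words_zero, desF_one]; simp
  | succ n ih =>
    rw [pow_succ', Module.End.mul_apply, ← ih]
    ext1 a
    rw [Bop_apply, Aw, sum_words_cons]
    refine Finset.sum_congr rfl fun b _ => ?_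
    rw [Aw, Finset.mul_sum]
    refine Finset.sum_congr rfl fun v _ => ?_
    rw [desF_cons, pow_add]
    congr 1
    simp only [Fin.cons_zero]
    split_ifs <;> simp

noncomputable def Xw (m n : ℕ) : ℕ → Polynomial ℤ :=
  ((Bop m + algebraMap (Polynomial ℤ) (Module.End (Polynomial ℤ) (ℕ → Polynomial ℤ)) X) ^ n)
    (fun _ => 1)

theorem Xw_zero (m a : ℕ) : Xw m 0 a = 1 := by simp [Xw]

theorem Xw_succ (m n a : ℕ) (ha : 1 ≤ a) (ha' : a ≤ m) :
    Xw m (n+1) a = ∑ b ∈ Finset.Ico a (m+1), Xw m n b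
      + X * ∑ b ∈ Finset.Ico 1 (a+1), Xw m n b := by
  have h : Xw m (n+1) = (Bop m + algebraMap (Polynomial ℤ)
      (Module.End (Polynomial ℤ) (ℕ → Polynomial ℤ)) X) (Xw m n) := by
    rw [Xw, pow_succ', Module.End.mul_apply]; rfl
  rw [h, LinearMap.add_apply, Pi.add_apply, Bop_apply, Module.algebraMap_end_apply,
    Finset.sum_Ico_succ_top ha, Pi.smul_apply, smul_eq_mul, mul_add, ← add_assoc]
  congr 1
  rw [← Finset.sum_filter_add_sum_filter_not _ (fun b => a ≤ b),
    filter_ge m a ha, filter_lt m a ha', Finset.mul_sum]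
  congr 1
  · refine Finset.sum_congr rfl fun b hb => ?_
    rw [if_neg (not_lt.2 (Finset.mem_Ico.1 hb).1), one_mul]
  · refine Finset.sum_congr rfl fun b hb => ?_
    rw [if_pos (Finset.mem_Ico.1 hb).2]

theorem Xw_binom (m n a : ℕ) :
    Xw m n a = ∑ k ∈ Finset.range (n+1), (n.choose k : Polynomial ℤ) * (X^k * Aw m (n-k) a) := by
  rw [Xw, add_comm, Commute.add_pow (show Commute _ _ from Algebra.commutes (X : Polynomial ℤ) (Bop m)),
    LinearMap.sum_apply, Finset.sum_apply]
  refine Finset.sum_congr rfl fun k _ => ?_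
  rw [← map_pow, Module.End.mul_apply, Module.End.mul_apply, Module.algebraMap_end_apply, Aw_eq]
  have : ((n.choose k : ℕ) : Module.End (Polynomial ℤ) (ℕ → Polynomial ℤ)) (fun _ => 1) =
    (n.choose k : Polynomial ℤ) • (fun _ => (1 : Polynomial ℤ)) := by
    rw [Module.End.natCast_apply]; ext1 i; simp
  rw [this, map_smul, Pi.smul_apply, Pi.smul_apply, smul_eq_mul, smul_eq_mul]
  ring

open Finset in
theorem sum_X_eq_Y (m n : ℕ) :
    ∑ a ∈ Icc 1 m, Xw m n a = ∑ a ∈ Icc 1 m, Yw m n a := by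
  have := alg_xy m (fun a => PowerSeries.mk fun n => Xw m n a)
    (fun a => PowerSeries.mk fun n => Yw m n a) ?_ ?_
  · have := congrArg (PowerSeries.coeff n) this
    simpa [map_sum, Finset.Ico_add_one_right_eq_Icc] using this
  · intro i h1 h2
    ext1 n
    simp only [mul_assoc, mul_one, one_mul, map_add]
    rcases n with _ | n
    · simp [Xw_zero]
    · simp only [PowerSeries.coeff_succ_X_mul, PowerSeries.coeff_C_mul, PowerSeries.coeff_mk, map_sum,
        Xw_succ m n i h1 h2, PowerSeries.coeff_one]
      simp
  · intro i h1 h2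
    ext1 n
    simp only [mul_assoc, mul_one, one_mul, map_add, pow_two, add_mul, mul_add]
    rcases n with _ | _ | n
    · simp [Yw_zero]
    · simp only [PowerSeries.coeff_succ_X_mul, PowerSeries.coeff_C_mul, PowerSeries.coeff_mk, map_sum,
        Yw_one m i h1, PowerSeries.coeff_one, zero_add, PowerSeries.coeff_zero_X_mul]
      simp [add_mul]
    · simp only [PowerSeries.coeff_succ_X_mul, PowerSeries.coeff_C_mul, PowerSeries.coeff_mk, map_sum,
        Yw_add_two m n i h1 h2, PowerSeries.coeff_one]
      simp [add_mul, add_assoc]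

theorem cycle_lemma (N : ℕ) (hN : 0 < N) (P : ℕ → ℤ) (hP : ∀ k, P (k + N) = P k - 1) :
    ∃! c : Fin N, ∀ k < N, P c ≤ P (c + k) := by
  have hex : ∃ c, c < N ∧ ∀ j < N, P c ≤ P j := by
    obtain ⟨c, hc, h⟩ := Finset.exists_min_image (Finset.range N) P ⟨0, by simpa using hN⟩
    exact ⟨c, by simpa using hc, fun j hj => h j (by simpa using hj)⟩
  have hs := Nat.find_spec hex
  have hm := fun k => Nat.find_min hex (m := k)
  set c := Nat.find hex
  refine ⟨⟨c, hs.1⟩, ?_, ?_⟩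
  · intro k hk
    show P c ≤ P (c + k)
    by_cases h : c + k < N
    · exact hs.2 _ h
    · have h1 : P (c + k) = P (c + k - N) - 1 := by
        rw [← hP, Nat.sub_add_cancel (by omega)]
      have h2 := hm (c + k - N) (by omega)
      have h3 : P c < P (c + k - N) := by
        by_contra h4
        exact h2 ⟨by omega, fun j hj => (not_lt.1 h4).trans (hs.2 j hj)⟩
      omega
  · have aux : ∀ a b : ℕ, a < b → b < N → (∀ k < N, P a ≤ P (a + k)) →
        (∀ k < N, P b ≤ P (b + k)) → False := by
      intro a b hab hb h1 h2
      have e1 := h1 (b - a) (by omega)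
      have e2 := h2 (a + N - b) (by omega)
      rw [show a + (b - a) = b by omega] at e1
      rw [show b + (a + N - b) = a + N by omega, hP] at e2
      omega
    intro d hd
    have hc : ∀ k < N, P c ≤ P (c + k) := by
      intro k hk
      by_cases h : c + k < N
      · exact hs.2 _ h
      · have h1 : P (c + k) = P (c + k - N) - 1 := by
          rw [← hP, Nat.sub_add_cancel (by omega)]
        have h2 := hm (c + k - N) (by omega)
        have h3 : P c < P (c + k - N) := by
          by_contra h4
          exact h2 ⟨by omega, fun j hj => (not_lt.1 h4).trans (hs.2 j hj)⟩
        omega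
    apply Fin.ext
    rcases lt_trichotomy (d : ℕ) c with h | h | h
    · exact (aux _ _ h hs.1 hd hc).elim
    · exact h
    · exact (aux _ _ h d.2 hc hd).elim

def Qp {n : ℕ} (u : Fin n → Fin (n+1)) : Prop :=
  ∀ k ≤ n, k ≤ (Finset.univ.filter fun i => (u i : ℕ) < k).card

theorem Qp_perm {n : ℕ} (u : Fin n → Fin (n+1)) (σ : Equiv.Perm (Fin n)) (h : Qp u) :
    Qp (u ∘ σ) := by
  intro k hk
  refine (h k hk).trans (le_of_eq ?_)
  refine Finset.card_bij (fun i _ => σ.symm i) ?_ ?_ ?_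
  · intro i hi; simpa using hi
  · intro a _ b _ hab; exact σ.symm.injective hab
  · intro b hb; exact ⟨σ b, by simpa using hb, by simp⟩

theorem sub_val_iff {n : ℕ} (a c : Fin (n+1)) (j : ℕ) (hj : j < n + 1) :
    ((a - c : Fin (n+1)) : ℕ) = j ↔ (a : ℕ) = (c + j) % (n+1) := by
  have h : ((a - c : Fin (n+1)) : ℕ) = j ↔ a - c = ⟨j, hj⟩ := by rw [Fin.ext_iff]
  rw [h, sub_eq_iff_eq_add, Fin.ext_iff, Fin.val_add, add_comm (c : ℕ) j]

theorem cyc {n : ℕ} (u : Fin n → Fin (n+1)) :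
    ∃! c : Fin (n+1), Qp (fun i => u i - c) := by
  let g : ℕ → ℤ := fun j =>
    ((Finset.univ.filter fun i => (u i : ℕ) = j % (n+1)).card : ℤ) - 1
  let P : ℕ → ℤ := fun k => ∑ j ∈ Finset.range k, g j
  have hcount : ∀ (c : Fin (n+1)) (k : ℕ), k ≤ n + 1 →
      (((Finset.univ.filter fun i => ((u i - c : Fin (n+1)) : ℕ) < k).card : ℤ))
        = P (c + k) - P c + k := by
    intro c k
    induction k with
    | zero => intro _; simp
    | succ k ih =>
      intro hk
      have hs : (Finset.univ.filter fun i => ((u i - c : Fin (n+1)) : ℕ) < k + 1) =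
        (Finset.univ.filter fun i => ((u i - c : Fin (n+1)) : ℕ) < k) ∪
        (Finset.univ.filter fun i => (u i : ℕ) = (c + k) % (n+1)) := by
        ext i
        simp only [Finset.mem_filter, Finset.mem_univ, true_and, Finset.mem_union]
        rw [← sub_val_iff _ _ _ (by omega)]
        omega
      rw [hs, Finset.card_union_of_disjoint]
      · push_cast
        rw [ih (by omega)]
        have : P (c + (k + 1)) = P (c + k) + g (c + k) := Finset.sum_range_succ _ _
        rw [this]
        simp only [g]
        ring
      · rw [Finset.disjoint_filter]
        intro i _ h1 h2
        rw [← sub_val_iff _ _ _ (by omega)] at h2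
        omega
  have hPN : P (n + 1) = -1 := by
    have := hcount 0 (n+1) le_rfl
    have h2 : (Finset.univ.filter fun i => ((u i - 0 : Fin (n+1)) : ℕ) < n + 1) = Finset.univ := by
      ext i; simp only [Finset.mem_filter, Finset.mem_univ, true_and, iff_true]
      exact (u i - 0).2
    rw [h2] at this
    have h0 : P 0 = 0 := Finset.sum_range_zero _
    simp only [Finset.card_univ, Fintype.card_fin, Fin.val_zero, zero_add, h0] at this
    push_cast at this
    linarith
  have hper : ∀ k, P (k + (n + 1)) = P k - 1 := by
    intro k
    have : P (n + 1 + k) = P (n+1) + ∑ j ∈ Finset.range k, g (n + 1 + j) :=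
      Finset.sum_range_add _ _ _
    rw [add_comm, this, hPN]
    have h2 : ∀ j, g (n + 1 + j) = g j := by
      intro j; simp only [g]; rw [Nat.add_mod_left]
    simp only [h2]
    ring
  have hQ : ∀ c : Fin (n+1), Qp (fun i => u i - c) ↔ ∀ k < n + 1, P c ≤ P (c + k) := by
    intro c
    unfold Qp
    refine forall_congr' fun k => ?_
    refine ⟨fun h hk => ?_, fun h hk => ?_⟩
    · have h1 := hcount c k (by omega)
      have h2 := h (by omega)
      simp only at h2 ⊢
      omega
    · have h1 := hcount c k (by omega)
      have h2 := h (by omega)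
      simp only
      omega
  simp only [hQ]
  exact cycle_lemma (n+1) (by omega) P hper

theorem parking_iff {n : ℕ} (u : Fin n → Fin (n+1)) :
    IsParkingFn (fun i => (u i : ℕ) + 1) ↔ Qp u := by
  constructor
  · rintro ⟨-, σ, -, h⟩ k hk
    have : ((Finset.univ.filter fun j : Fin n => (j : ℕ) < k).map σ.toEmbedding) ⊆
        Finset.univ.filter fun i => (u i : ℕ) < k := by
      intro i hi
      simp only [Finset.mem_map, Finset.mem_filter, Finset.mem_univ, true_and] at hi ⊢
      obtain ⟨j, hj, rfl⟩ := hi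
      have := h j
      simp only at this
      simp only [Equiv.coe_toEmbedding]
      omega
    have h2 := Finset.card_le_card this
    rw [Finset.card_map, Fin.card_filter_val_lt] at h2
    omega
  · intro h
    refine ⟨fun i => Nat.le_add_left 1 _, Tuple.sort (fun i => (u i : ℕ) + 1), Tuple.monotone_sort _, ?_⟩
    have hmono := Tuple.monotone_sort (fun i => (u i : ℕ) + 1)
    set σ := Tuple.sort (fun i => (u i : ℕ) + 1)
    intro i
    by_contra hc
    simp only at hc
    have h1 := Qp_perm u σ h (i+1) (by have := i.2; omega)
    have h2 : (Finset.univ.filter fun j => ((u ∘ σ) j : ℕ) < i + 1) ⊆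
        Finset.univ.filter fun j : Fin n => (j : ℕ) < i := by
      intro j hj
      simp only [Finset.mem_filter, Finset.mem_univ, true_and, Function.comp] at hj ⊢
      by_contra hji
      have := hmono (show i ≤ j from by rw [Fin.le_def]; omega)
      simp only [Function.comp] at this
      omega
    have h3 := Finset.card_le_card h2
    rw [Fin.card_filter_val_lt] at h3
    omega

def DS {n : ℕ} (w : Fin n → ℕ) : Finset ℕ :=
  (Finset.range n).filter fun i => ∃ h : i + 1 < n, w ⟨i+1, h⟩ < w ⟨i, by omega⟩

def wd {n : ℕ} (u : Fin n → Fin (n+1)) : Fin n → ℕ := fun i => (u i : ℕ) + 1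

def blk (T : Finset ℕ) {n : ℕ} (i : Fin n) : ℕ := (T.filter fun j => j < (i : ℕ)).card

def keyT (T : Finset ℕ) {n : ℕ} (u : Fin n → Fin (n+1)) (i : Fin n) : ℕ ×ₗ Fin (n+1) :=
  toLex (blk T i, u i)

theorem blk_mono (T : Finset ℕ) {n : ℕ} : Monotone (blk T : Fin n → ℕ) := by
  intro i j hij
  refine Finset.card_le_card fun x hx => ?_
  simp only [Finset.mem_filter] at hx ⊢
  exact ⟨hx.1, hx.2.trans_le hij⟩

theorem sorted_iff (T : Finset ℕ) {n : ℕ} (u : Fin n → Fin (n+1)) :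
    Monotone (keyT T u) ↔ DS (wd u) ⊆ T := by
  have hsucc : ∀ i (h : i + 1 < n), blk T (⟨i+1, h⟩ : Fin n) =
      blk T (⟨i, by omega⟩ : Fin n) + if i ∈ T then 1 else 0 := by
    intro i h
    unfold blk
    simp only
    have : (T.filter fun j => j < i + 1) =
        (T.filter fun j => j < i) ∪ (T.filter fun j => j = i) := by
      ext x; simp only [Finset.mem_filter, Finset.mem_union]
      rw [← and_or_left, Nat.lt_succ_iff_lt_or_eq]
    rw [this, Finset.card_union_of_disjoint, Finset.filter_eq']
    · split_ifs <;> simp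
    · rw [Finset.disjoint_filter]; intro x _ h1 h2; omega
  constructor
  · intro hm i hi
    simp only [DS, Finset.mem_filter] at hi
    obtain ⟨-, h, hlt⟩ := hi
    by_contra hT
    have := hm (show (⟨i, by omega⟩ : Fin n) ≤ ⟨i+1, h⟩ from by simp [Fin.le_def])
    rw [keyT, keyT, Prod.Lex.toLex_le_toLex'] at this
    have h2 := this.2 (by simp [hsucc i h, hT])
    simp only [wd, Fin.le_def] at hlt h2
    omega
  · intro hD
    have step : ∀ i (h : i + 1 < n), keyT T u ⟨i, by omega⟩ ≤ keyT T u ⟨i+1, h⟩ := by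
      intro i h
      rw [keyT, keyT, Prod.Lex.toLex_le_toLex']
      refine ⟨blk_mono T (by simp [Fin.le_def]), fun he => ?_⟩
      have he' : blk T (⟨i, by omega⟩ : Fin n) = blk T (⟨i+1, h⟩ : Fin n) := he
      rw [hsucc i h] at he'
      have hT : i ∉ T := by
        intro hT; simp [hT] at he'
      by_contra hlt
      apply hT
      apply hD
      simp only [DS, Finset.mem_filter, Finset.mem_range]
      refine ⟨by omega, h, ?_⟩
      simp only [wd, Fin.le_def] at hlt ⊢
      omega
    have main : ∀ d i (h : i + d < n), keyT T u ⟨i, by omega⟩ ≤ keyT T u ⟨i+d, h⟩ := by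
      intro d
      induction d with
      | zero => intro i h; exact le_refl _
      | succ d ih => intro i h; exact (ih i (by omega)).trans (step (i+d) (by omega))
    intro i j hij
    have h1 := main (j - i) i (by rw [Fin.le_def] at hij; omega)
    have h2 : (⟨(i:ℕ) + ((j:ℕ) - i), by rw [Fin.le_def] at hij; omega⟩ : Fin n) = j := by
      apply Fin.ext; rw [Fin.le_def] at hij; simp only; omega
    rw [h2] at h1
    exact h1

theorem keyT_comp (T : Finset ℕ) {n : ℕ} (u : Fin n → Fin (n+1)) (σ : Equiv.Perm (Fin n))
    (h : ∀ i, blk T (σ i) = blk T i) : keyT T (u ∘ σ) = keyT T u ∘ σ := by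
  ext1 i; simp [keyT, h]

theorem sorted_unique (T : Finset ℕ) {n : ℕ} (u : Fin n → Fin (n+1)) (σ : Equiv.Perm (Fin n))
    (h : ∀ i, blk T (σ i) = blk T i) (h1 : Monotone (keyT T u)) (h2 : Monotone (keyT T (u ∘ σ))) :
    u ∘ σ = u := by
  rw [keyT_comp T u σ h] at h2
  have := Tuple.unique_monotone (f := keyT T u) (σ := σ) (τ := Equiv.refl _) h2 h1
  ext1 i
  have h3 := congrFun this i
  simp only [keyT, Function.comp, Equiv.refl_apply, EmbeddingLike.apply_eq_iff_eq, Prod.mk.injEq] at h3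
  exact h3.2

theorem exists_sort (T : Finset ℕ) {n : ℕ} (u : Fin n → Fin (n+1)) :
    ∃ σ : Equiv.Perm (Fin n), (∀ i, blk T (σ i) = blk T i) ∧ Monotone (keyT T (u ∘ σ)) := by
  refine ⟨Tuple.sort (keyT T u), ?_⟩
  have hm := Tuple.monotone_sort (keyT T u)
  set σ := Tuple.sort (keyT T u)
  have hb : ∀ i, blk T (σ i) = blk T i := by
    have h1 : Monotone (blk T ∘ σ) := by
      intro i j hij
      have := hm hij
      simp only [Function.comp, keyT] at this
      rw [Prod.Lex.toLex_le_toLex'] at this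
      exact this.1
    have := Tuple.unique_monotone (f := (blk T : Fin n → ℕ)) (σ := σ) (τ := Equiv.refl _) h1
      (blk_mono T)
    exact fun i => congrFun this i
  refine ⟨hb, ?_⟩
  rw [keyT_comp T u σ hb]
  exact hm

theorem count_sub (n : ℕ) (T : Finset ℕ) :
    (Finset.univ.filter fun u : Fin n → Fin (n+1) => DS (wd u) ⊆ T).card =
    (n + 1) * (Finset.univ.filter fun u : Fin n → Fin (n+1) => Qp u ∧ DS (wd u) ⊆ T).card := by
  simp only [← sorted_iff]
  have hcard : (n + 1) * (Finset.univ.filter fun u : Fin n → Fin (n+1) =>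
      Qp u ∧ Monotone (keyT T u)).card =
    ((Finset.univ.filter fun u : Fin n → Fin (n+1) => Qp u ∧ Monotone (keyT T u)) ×ˢ
      (Finset.univ : Finset (Fin (n+1)))).card := by
    rw [Finset.card_product, Finset.card_univ, Fintype.card_fin, mul_comm]
  rw [hcard]
  symm
  choose s hs1 hs2 using fun u : Fin n → Fin (n+1) => exists_sort T u
  refine Finset.card_bij (fun p _ => (fun i => p.1 i + p.2) ∘ s (fun i => p.1 i + p.2)) ?_ ?_ ?_
  · intro p _
    simp only [Finset.mem_filter, Finset.mem_univ, true_and]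
    exact hs2 _
  · rintro ⟨u, c⟩ hu ⟨u', c'⟩ hu' heq
    simp only [Finset.mem_product, Finset.mem_filter, Finset.mem_univ, true_and, and_true] at hu hu'
    simp only at heq
    have b1 := hs1 (fun i => u i + c)
    have b2 := hs1 (fun i => u' i + c')
    set σ := s (fun i => u i + c)
    set σ' := s (fun i => u' i + c')
    have he : ∀ i, u i + c = u' ((σ.symm.trans σ') i) + c' := by
      intro i
      have := congrFun heq (σ.symm i)
      simpa using this
    have hb : ∀ i, blk T ((σ.symm.trans σ') i) = blk T i := by
      intro i
      rw [Equiv.trans_apply, b2, ← b1 (σ.symm i), Equiv.apply_symm_apply]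
    set ρ := σ.symm.trans σ'
    have hc : c = c' := by
      refine (cyc (fun i => u i + c)).unique ?_ ?_
      · simpa using hu.1
      · simp only [he, add_sub_cancel_right]
        exact Qp_perm u' ρ hu'.1
    subst hc
    have hu2 : u = u' ∘ ρ := by
      ext1 i
      exact add_right_cancel (he i)
    have : u' ∘ ρ = u' := sorted_unique T u' ρ hb hu'.2 (hu2 ▸ hu.2)
    rw [hu2, this]
  · intro v hv
    simp only [Finset.mem_filter, Finset.mem_univ, true_and] at hv
    obtain ⟨c, hc, -⟩ := cyc v
    refine ⟨((fun i => v i - c) ∘ s (fun i => v i - c), c), ?_, ?_⟩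
    · simp only [Finset.mem_product, Finset.mem_filter, Finset.mem_univ, true_and, and_true]
      exact ⟨Qp_perm _ _ hc, hs2 _⟩
    · simp only [Function.comp, sub_add_cancel]
      set σ := s (fun i => v i - c)
      have b1 : ∀ i, blk T (σ i) = blk T i := hs1 _
      have m2 := hs2 (fun i => v (σ i))
      have b2 := hs1 (fun i => v (σ i))
      set σ' := s (fun i => v (σ i))
      refine sorted_unique T v (σ'.trans σ) (fun i => ?_) hv m2
      rw [Equiv.trans_apply, b1, b2]

theorem count_eq (n : ℕ) (T : Finset ℕ) :
    (Finset.univ.filter fun u : Fin n → Fin (n+1) => DS (wd u) = T).card =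
    (n + 1) * (Finset.univ.filter fun u : Fin n → Fin (n+1) => Qp u ∧ DS (wd u) = T).card := by
  induction T using Finset.strongInduction with
  | _ T ih =>
    have h := count_sub n T
    have e1 : (Finset.univ.filter fun u : Fin n → Fin (n+1) => DS (wd u) ⊆ T).card =
        ∑ D ∈ T.powerset,
          (Finset.univ.filter fun u : Fin n → Fin (n+1) => DS (wd u) = D).card := by
      rw [Finset.card_eq_sum_card_fiberwise (f := fun u => DS (wd u)) (t := T.powerset)]
      · refine Finset.sum_congr rfl fun D hD => ?_
        rw [Finset.filter_filter]
        congr 1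
        ext u
        simp only [Finset.mem_filter, Finset.mem_univ, true_and, Finset.mem_powerset] at hD ⊢
        exact ⟨fun h => h.2, fun h => ⟨h ▸ hD, h⟩⟩
      · intro u hu
        simpa using hu
    have e2 : (Finset.univ.filter fun u : Fin n → Fin (n+1) => Qp u ∧ DS (wd u) ⊆ T).card =
        ∑ D ∈ T.powerset,
          (Finset.univ.filter fun u : Fin n → Fin (n+1) => Qp u ∧ DS (wd u) = D).card := by
      rw [Finset.card_eq_sum_card_fiberwise (f := fun u => DS (wd u)) (t := T.powerset)]
      · refine Finset.sum_congr rfl fun D hD => ?_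
        rw [Finset.filter_filter]
        congr 1
        ext u
        simp only [Finset.mem_filter, Finset.mem_univ, true_and, Finset.mem_powerset] at hD ⊢
        exact ⟨fun h => ⟨h.1.1, h.2⟩, fun h => ⟨⟨h.1, h.2 ▸ hD⟩, h.2⟩⟩
      · intro u hu
        have hu' : Qp u ∧ DS (wd u) ⊆ T := by simpa using hu
        simpa using hu'.2
    rw [e1, e2, ← Finset.sum_erase_add _ _ (Finset.mem_powerset_self T),
      ← Finset.sum_erase_add _ _ (Finset.mem_powerset_self T), mul_add] at h
    have e3 : ∑ D ∈ T.powerset.erase T,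
          (Finset.univ.filter fun u : Fin n → Fin (n+1) => DS (wd u) = D).card =
        (n + 1) * ∑ D ∈ T.powerset.erase T,
          (Finset.univ.filter fun u : Fin n → Fin (n+1) => Qp u ∧ DS (wd u) = D).card := by
      rw [Finset.mul_sum]
      refine Finset.sum_congr rfl fun D hD => ih D ?_
      rw [Finset.mem_erase, Finset.mem_powerset] at hD
      exact Finset.ssubset_iff_subset_ne.2 ⟨hD.2, hD.1⟩
    omega

theorem transfer (n : ℕ) (f : (Fin n → ℕ) → Polynomial ℤ)
    (hf : ∀ w w' : Fin n → ℕ, DS w = DS w' → f w = f w') :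
    ∑ u : Fin n → Fin (n+1), f (wd u) =
      ((n : Polynomial ℤ) + 1) * ∑ u : Fin n → Fin (n+1) with Qp u, f (wd u) := by
  have hmap : ∀ s : Finset (Fin n → Fin (n+1)), ∑ u ∈ s, f (wd u) =
      ∑ D ∈ (Finset.range n).powerset, ∑ u ∈ s with DS (wd u) = D, f (wd u) := by
    intro s
    rw [Finset.sum_fiberwise_of_maps_to]
    intro u _
    rw [Finset.mem_powerset]
    exact Finset.filter_subset _ _
  rw [hmap, hmap, Finset.mul_sum]
  refine Finset.sum_congr rfl fun D _ => ?_
  rw [Finset.filter_filter]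
  have hc := count_eq n D
  by_cases hne : ∃ u : Fin n → Fin (n+1), DS (wd u) = D
  · obtain ⟨u0, h0⟩ := hne
    rw [Finset.sum_congr rfl (g := fun _ => f (wd u0)), Finset.sum_const, hc,
      Finset.sum_congr rfl (g := fun _ => f (wd u0)), Finset.sum_const]
    · simp only [nsmul_eq_mul]; push_cast; ring
    · intro u hu
      simp only [Finset.mem_filter] at hu
      exact hf _ _ (hu.2.2.trans h0.symm)
    · intro u hu
      simp only [Finset.mem_filter] at hu
      exact hf _ _ (hu.2.trans h0.symm)
  · push Not at hne
    rw [Finset.filter_false_of_mem (fun u _ => hne u),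
      Finset.filter_false_of_mem (fun u _ h => hne u h.2)]
    simp

theorem sum_words_fin (n : ℕ) (f : (Fin n → ℕ) → Polynomial ℤ) :
    ∑ w ∈ Fintype.piFinset (fun _ : Fin n => Finset.Icc 1 (n+1)), f w =
      ∑ u : Fin n → Fin (n+1), f (wd u) := by
  symm
  refine Finset.sum_bij (fun u _ => wd u) ?_ ?_ ?_ ?_
  · intro u _
    simp only [Fintype.mem_piFinset, wd, Finset.mem_Icc]
    intro i; have := (u i).2; omega
  · intro u _ u' _ h
    ext1 i
    have := congrFun h i
    simp only [wd] at this
    apply Fin.ext; omega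
  · intro w hw
    simp only [Fintype.mem_piFinset, Finset.mem_Icc] at hw
    refine ⟨fun i => ⟨w i - 1, by have := hw i; omega⟩, Finset.mem_univ _, ?_⟩
    ext1 i
    have := hw i
    simp only [wd]; omega
  · intro u _; rfl

theorem pf_eq (n : ℕ) :
    pfFinset n = (Fintype.piFinset fun _ : Fin n => Finset.Icc 1 (n+1)).filter IsParkingFn := by
  unfold pfFinset
  ext w
  simp only [Finset.mem_filter, Fintype.mem_piFinset, Finset.mem_Icc]
  refine and_congr_left fun h => ⟨fun h1 i => ⟨(h1 i).1, by have := (h1 i).2; omega⟩, fun _ i => ?_⟩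
  refine ⟨h.1 i, ?_⟩
  obtain ⟨-, σ, -, h2⟩ := h
  have := h2 (σ.symm i)
  rw [Equiv.apply_symm_apply] at this
  have := (σ.symm i).2
  omega

theorem sum_pf (n : ℕ) (f : (Fin n → ℕ) → Polynomial ℤ)
    (hf : ∀ w w' : Fin n → ℕ, DS w = DS w' → f w = f w') :
    ((n : Polynomial ℤ) + 1) * ∑ w ∈ pfFinset n, f w =
    ∑ w ∈ Fintype.piFinset (fun _ : Fin n => Finset.Icc 1 (n+1)), f w := by
  rw [sum_words_fin, transfer n f hf, pf_eq, Finset.sum_filter, sum_words_fin, Finset.sum_filter]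
  congr 1
  refine Finset.sum_congr rfl fun u _ => ?_
  have : IsParkingFn (wd u) ↔ Qp u := parking_iff u
  simp only [this]

theorem Gw_congr {n : ℕ} (w w' : Fin (n+1) → ℕ) (h : DS w = DS w') : Gw w = Gw w' := by
  have hd : ∀ i (hi : i + 1 < n + 1),
      w ⟨i+1, hi⟩ < w ⟨i, by omega⟩ ↔ w' ⟨i+1, hi⟩ < w' ⟨i, by omega⟩ := by
    intro i hi
    have := Finset.ext_iff.1 h i
    simp only [DS, Finset.mem_filter, Finset.mem_range] at this
    constructor
    · intro hh
      exact (this.1 ⟨by omega, hi, hh⟩).2.2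
    · intro hh
      exact (this.2 ⟨by omega, hi, hh⟩).2.2
  have h1 : desF w = desF w' := by
    unfold desF
    congr 1
    refine Finset.filter_congr fun i _ => ?_
    exact hd i (by have := i.2; omega)
  have h2 : GoodF w ↔ GoodF w' := by
    unfold GoodF
    refine and_congr ?_ ?_
    · unfold NDDF
      refine forall_congr' fun i => forall_congr' fun hi => ?_
      have e1 := hd i (by omega)
      have e2 := hd (i+1) (by omega)
      exact not_congr (and_congr e1 e2)
    · rcases n with _ | n
      · exact iff_of_true (le_refl _) (le_refl _)
      · have e := hd n (by omega)
        rw [← not_lt, ← not_lt]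
        exact not_congr e
  unfold Gw
  simp only [h1, h2]

theorem main_aux (n : ℕ) :
    (((n+1 : ℕ) : Polynomial ℤ) + 1) * ∑ w ∈ pfFinset (n+1), Gw w =
      ∑ k ∈ Finset.range (n+1), (n.choose k : Polynomial ℤ) *
        (X ^ k * ∑ a ∈ Finset.Icc 1 (n+2), Aw (n+2) (n-k) a) := by
  rw [sum_pf (n+1) Gw Gw_congr, sum_words_cons]
  have := sum_X_eq_Y (n+2) n
  rw [show ∑ a ∈ Finset.Icc 1 (n+1+1), ∑ v ∈ Fintype.piFinset (fun _ : Fin n => Finset.Icc 1 (n+1+1)),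
    Gw (Fin.cons a v : Fin (n+1) → ℕ) = ∑ a ∈ Finset.Icc 1 (n+2), Yw (n+2) n a from rfl, ← this]
  simp only [Xw_binom]
  rw [Finset.sum_comm]
  refine Finset.sum_congr rfl fun k _ => ?_
  rw [Finset.mul_sum, Finset.mul_sum]

theorem sum_Aw (m j N : ℕ) (hN : N = j + 1) (k : ℕ) :
    ∑ u ∈ Fintype.piFinset (fun _ : Fin N => Finset.Icc 1 m), (X : Polynomial ℤ) ^ (desF u + k) =
      X ^ k * ∑ a ∈ Finset.Icc 1 m, Aw m j a := by
  subst hN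
  rw [sum_words_cons, Finset.mul_sum]
  refine Finset.sum_congr rfl fun a _ => ?_
  rw [Aw, Finset.mul_sum]
  refine Finset.sum_congr rfl fun v _ => ?_
  rw [pow_add, mul_comm]

/-- the identity behind eq. (8.3)/(8.8)/(8.10) of
Linusson–Shareshian–Wachs: for `n ≥ 1`,
`(n+1) ∑ t^{des w} (1+t)^{n-1-2 des w} = ∑_{k=0}^{n-1} C(n-1,k) ∑_{w ∈ [n+1]^{n-k}} t^{des w + k}`
in `ℤ[t]`, where the left sum is over all parking functions `w` of length `n` with no
double descent satisfying `w_{n-1} ≤ w_n` (vacuous for `n = 1`). -/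
theorem statement_14 (n : ℕ) (hn : 1 ≤ n) :
    ((n : Polynomial ℤ) + 1) *
        ∑ w ∈ (pfFinset n).filter
            (fun w => NDDF w ∧ w ⟨n - 2, by omega⟩ ≤ w ⟨n - 1, by omega⟩),
          (X : Polynomial ℤ) ^ desF w * (X + 1) ^ (n - 1 - 2 * desF w) =
      ∑ k ∈ Finset.range n, ((n - 1).choose k : Polynomial ℤ) *
        ∑ u ∈ Fintype.piFinset (fun _ : Fin (n - k) => Finset.Icc 1 (n + 1)),
          (X : Polynomial ℤ) ^ (desF u + k) := by
  obtain ⟨n, rfl⟩ : ∃ j, n = j + 1 := ⟨n - 1, by omega⟩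
  have h := main_aux n
  have hL : ∑ w ∈ pfFinset (n+1), Gw w = ∑ w ∈ (pfFinset (n+1)).filter
            (fun w => NDDF w ∧ w ⟨n + 1 - 2, by omega⟩ ≤ w ⟨n + 1 - 1, by omega⟩),
          (X : Polynomial ℤ) ^ desF w * (X + 1) ^ (n + 1 - 1 - 2 * desF w) := by
    rw [Finset.sum_filter]
    refine Finset.sum_congr rfl fun w _ => ?_
    unfold Gw GoodF
    congr 1
  rw [← hL, h]
  refine Finset.sum_congr rfl fun k hk => ?_
  rw [Finset.mem_range] at hk
  rw [sum_Aw (n+1+1) (n-k) (n+1-k) (by omega) k]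
  rfl
end

section
/- For every n ≥ 1, the sum of 2^{n−1−2·des(w)}, taken over all parking functions w of length n that have no double descent and satisfy w_{n−1} ≤ w_n (this condition being vacuous when n = 1), equals (n+2)^{n−1}. -/
attribute [local instance] Classical.propDecidable

open Polynomial

noncomputable def cv (f g : List ℕ → ℤ) : List ℕ → ℤ
  | [] => f [] * g []
  | a :: l => f [] * g (a :: l) + cv (fun x => f (a :: x)) g l

noncomputable def WN : List ℕ → ℤ × ℤ
  | [] => (1, 1)
  | [_] => (1, 0)
  | a :: b :: l => if a ≤ b then (2 * (WN (b :: l)).1, (WN (b :: l)).1) else ((WN (b :: l)).2, 0)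

noncomputable def VV {α : Type} : List α → ℤ
  | [] => 1
  | [_] => 1
  | a :: b :: l => if a = b then 2 * VV (b :: l) else VV (b :: l)

noncomputable def DD (l : List ℕ) : ℤ := if l.IsChain (· ≤ ·) then 1 else 0
noncomputable def PP (l : List ℕ) : ℤ := if l ≠ [] ∧ l.IsChain (· = ·) then 1 else 0
noncomputable def EE (l : List ℕ) : ℤ := (l.length : ℤ) * DD l
noncomputable def II (l : List ℕ) : ℤ := if l = [] then 1 else 0
noncomputable def KK (l : List ℕ) : ℤ := EE l + (-1) * DD l + II l
noncomputable def DP (l : List ℕ) : ℤ := DD l + (-1) * II l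

theorem cv_add (f f' g : List ℕ → ℤ) (l : List ℕ) :
    cv (fun x => f x + f' x) g l = cv f g l + cv f' g l := by
  induction l generalizing f f' with
  | nil => simp [cv]; ring
  | cons a l ih => simp only [cv, ih]; ring

theorem cv_zero (g : List ℕ → ℤ) (l : List ℕ) : cv (fun _ => 0) g l = 0 := by
  induction l with
  | nil => simp [cv]
  | cons a l ih => simp only [cv, ih]; ring

theorem cv_eq_sum (f g : List ℕ → ℤ) (l : List ℕ) :
    cv f g l = ∑ i ∈ Finset.range (l.length + 1), f (l.take i) * g (l.drop i) := by
  induction l generalizing f with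
  | nil => simp [cv]
  | cons a l ih =>
    rw [cv, ih, List.length_cons, Finset.sum_range_succ' _ (l.length + 1)]
    simp; ring

theorem DD_cc (a b : ℕ) (x : List ℕ) : DD (a :: b :: x) = if a ≤ b then DD (b :: x) else 0 := by
  simp only [DD, List.isChain_cons_cons]; split_ifs <;> simp_all

theorem KK_nil : KK [] = 0 := by simp [KK, EE, DD, II]
theorem KK_one (a : ℕ) : KK [a] = 0 := by simp [KK, EE, DD, II]
theorem DP_nil : DP [] = 0 := by simp [DP, DD, II]
theorem DP_one (a : ℕ) : DP [a] = 1 := by simp [DP, DD, II]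
theorem DP_cc (a b : ℕ) (x : List ℕ) : DP (a :: b :: x) = if a ≤ b then DP (b :: x) else 0 := by
  simp only [DP, II, DD_cc]; split_ifs <;> simp_all
theorem KK_cc (a b : ℕ) (x : List ℕ) :
    KK (a :: b :: x) = if a ≤ b then KK (b :: x) + DP (b :: x) else 0 := by
  simp only [KK, EE, DP, II, DD_cc]; split_ifs <;> simp_all; ring
theorem PP_nil : PP [] = 0 := by simp [PP]
theorem PP_one (a : ℕ) : PP [a] = 1 := by simp [PP]
theorem PP_cc (a b : ℕ) (x : List ℕ) : PP (a :: b :: x) = if a = b then PP (b :: x) else 0 := by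
  simp only [PP, List.isChain_cons_cons]; split_ifs <;> simp_all

theorem cv_DP (a : ℕ) (l : List ℕ) :
    cv DP (fun x => (WN x).2) (a :: l) = (WN (a :: l)).1 - (WN (a :: l)).2 := by
  induction l generalizing a with
  | nil => simp [cv, DP_nil, DP_one, WN]
  | cons b l ih =>
    have h := ih b
    simp only [cv, DP_nil, DP_one, DP_cc] at h ⊢
    by_cases hab : a ≤ b
    · simp only [hab, if_true, WN]
      linarith
    · simp only [hab, if_false, WN, cv_zero]
      ring

theorem cv_KK (a : ℕ) (l : List ℕ) :
    cv KK (fun x => (WN x).2) (a :: l) = (WN (a :: l)).2 := by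
  induction l generalizing a with
  | nil => simp [cv, KK_nil, KK_one, WN]
  | cons b l ih =>
    have h := ih b
    have h2 := cv_DP b l
    simp only [cv, DP_nil, KK_nil, KK_one, KK_cc] at h h2 ⊢
    by_cases hab : a ≤ b
    · simp only [hab, if_true, WN, cv_add]
      linarith
    · simp only [hab, if_false, WN, cv_zero]
      ring

theorem cv_PP (a : ℕ) (l : List ℕ) : cv PP VV (a :: l) = VV (a :: l) := by
  induction l generalizing a with
  | nil => simp [cv, PP_nil, PP_one, VV]
  | cons b l ih =>
    have h := ih b
    simp only [cv, PP_nil, PP_one, PP_cc] at h ⊢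
    by_cases hab : a = b
    · simp only [hab, if_true, VV]
      linarith
    · simp only [hab, if_false, VV, cv_zero]
      ring

theorem cv_II (g : List ℕ → ℤ) (l : List ℕ) : cv II g l = g l := by
  cases l with
  | nil => simp [cv, II]
  | cons a l =>
    have : (fun x => II (a :: x)) = fun _ => 0 := by funext x; simp [II]
    rw [cv, this, cv_zero]; simp [II]

theorem W_eq : (fun l => (WN l).1) = cv DD (fun x => (WN x).2) := by
  have e : DD = fun x => DP x + II x := by funext x; simp [DP]
  funext l
  rw [e, cv_add, cv_II]
  cases l with
  | nil => simp [cv, DP_nil, WN]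
  | cons a l => rw [cv_DP]; ring

theorem N_eq : (fun l => (WN l).2) = fun l => II l + cv KK (fun x => (WN x).2) l := by
  funext l
  cases l with
  | nil => simp [cv, KK_nil, II, WN]
  | cons a l => rw [cv_KK]; simp [II]

theorem V_eq : VV = fun l => II l + cv PP VV l := by
  funext l
  cases l with
  | nil => simp [cv, PP_nil, II, VV]
  | cons a l => rw [cv_PP]; simp [II]

noncomputable def lsF (s : Multiset ℕ) : Finset (List ℕ) := s.lists.toFinset

theorem mem_lsF (s : Multiset ℕ) (l : List ℕ) : l ∈ lsF s ↔ s = (l : Multiset ℕ) := by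
  rw [lsF, Multiset.mem_toFinset, Multiset.mem_lists_iff]; rfl

noncomputable def ab (f : List ℕ → ℤ) : MvPowerSeries ℕ ℤ :=
  fun m => ∑ l ∈ (lsF (Finsupp.toMultiset m)), f l

theorem ab_add (f g : List ℕ → ℤ) : ab (fun l => f l + g l) = ab f + ab g := by
  funext m
  exact Finset.sum_add_distrib

theorem coeff_ab (f : List ℕ → ℤ) (m : ℕ →₀ ℕ) :
    MvPowerSeries.coeff m (ab f) = ∑ l ∈ (lsF (Finsupp.toMultiset m)), f l := rfl

theorem mem_ls (m : ℕ →₀ ℕ) (l : List ℕ) :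
    l ∈ (lsF (Finsupp.toMultiset m)) ↔ m = Multiset.toFinsupp (l : Multiset ℕ) := by
  rw [mem_lsF, ← Finsupp.toMultiset_eq_iff]

theorem mem_ad {inst : Finset.HasAntidiagonal (ℕ →₀ ℕ)} (m : ℕ →₀ ℕ) (p : (ℕ →₀ ℕ) × (ℕ →₀ ℕ)) :
    p ∈ @Finset.HasAntidiagonal.antidiagonal _ _ inst m ↔ p.1 + p.2 = m :=
  @Finset.HasAntidiagonal.mem_antidiagonal _ _ inst m p

theorem ab_mul (f g : List ℕ → ℤ) : ab (cv f g) = ab f * ab g := by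
  ext m
  rw [MvPowerSeries.coeff_mul]
  simp only [coeff_ab, Finset.sum_mul_sum, ← Finset.sum_product']
  simp only [cv_eq_sum]
  rw [Finset.sum_sigma', Finset.sum_sigma']
  refine Finset.sum_bij'
    (fun x _ => ⟨(Multiset.toFinsupp (x.1.take x.2 : Multiset ℕ), Multiset.toFinsupp (x.1.drop x.2 : Multiset ℕ)), (x.1.take x.2, x.1.drop x.2)⟩)
    (fun y _ => ⟨y.2.1 ++ y.2.2, y.2.1.length⟩) ?_ ?_ ?_ ?_ ?_
  · rintro ⟨l, i⟩ h
    simp only [Finset.mem_sigma, mem_ls, Finset.mem_range] at h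
    simp only [Finset.mem_sigma, Finset.mem_product, mem_ls, mem_ad, and_true]
    rw [← map_add, Multiset.coe_add, List.take_append_drop, h.1]
  · rintro ⟨⟨m1, m2⟩, ⟨u, v⟩⟩ h
    simp only [Finset.mem_sigma, Finset.mem_product, mem_ls, mem_ad] at h
    simp only [Finset.mem_sigma, mem_ls, Finset.mem_range, List.length_append]
    refine ⟨?_, by omega⟩
    rw [← Multiset.coe_add, map_add, ← h.2.1, ← h.2.2, h.1]
  · rintro ⟨l, i⟩ h
    simp only [Finset.mem_sigma, mem_ls, Finset.mem_range] at h
    simp; omega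
  · rintro ⟨⟨m1, m2⟩, ⟨u, v⟩⟩ h
    simp only [Finset.mem_sigma, Finset.mem_product, mem_ls, mem_ad] at h
    obtain ⟨h0, h1, h2⟩ := h
    subst h1 h2
    simp
  · rintro ⟨l, i⟩ h
    simp

theorem ab_II : ab II = 1 := by
  ext m
  rw [coeff_ab, MvPowerSeries.coeff_one]
  simp only [II, Finset.sum_ite_eq', mem_ls]
  simp

theorem coeff_DD (m : ℕ →₀ ℕ) : MvPowerSeries.coeff m (ab DD) = 1 := by
  rw [coeff_ab]
  rw [Finset.sum_eq_single ((Finsupp.toMultiset m).sort (· ≤ ·))]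
  · rw [DD, if_pos]
    exact (Multiset.pairwise_sort _ _).isChain
  · intro l hl hne
    rw [DD, if_neg]
    intro hc
    apply hne
    rw [List.isChain_iff_pairwise] at hc
    rw [mem_lsF] at hl
    rw [hl, Multiset.coe_sort, List.mergeSort_of_pairwise]
    simpa using hc
  · intro h
    exact absurd (by rw [mem_lsF]; simp) h

theorem ab_EE : ab EE = ab DD * ab PP := by
  ext m
  have h1 : MvPowerSeries.coeff m (ab EE) = ∑ a ∈ m.support, (m a : ℤ) := by
    rw [← mul_one (∑ a ∈ m.support, (m a : ℤ)), ← coeff_DD m, coeff_ab, coeff_ab, Finset.mul_sum]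
    refine Finset.sum_congr rfl fun l hl => ?_
    rw [mem_lsF] at hl
    rw [EE, ← Multiset.coe_card, ← hl, Finsupp.card_toMultiset, Finsupp.sum]
    simp
  have hP : ∀ m : ℕ →₀ ℕ, MvPowerSeries.coeff m (ab PP) = if ∃ a k, 1 ≤ k ∧ m = Finsupp.single a k then 1 else 0 := by
    intro m
    rw [coeff_ab]
    split_ifs with h
    · obtain ⟨a, k, hk, rfl⟩ := h
      rw [Finset.sum_eq_single (List.replicate k a)]
      · rw [PP, if_pos]
        refine ⟨by simp; omega, ?_⟩
        apply List.Pairwise.isChain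
        simp [List.pairwise_replicate]
      · intro l hl hne
        rw [mem_lsF] at hl
        exfalso; apply hne
        rw [List.eq_replicate_iff]
        rw [Finsupp.toMultiset_single, Multiset.nsmul_singleton] at hl
        constructor
        · rw [← Multiset.coe_card, ← hl]; simp
        · intro b hb
          rw [← Multiset.mem_coe, ← hl] at hb
          exact Multiset.eq_of_mem_replicate hb
      · intro h
        refine absurd ?_ h
        rw [mem_lsF]; simp [Multiset.nsmul_singleton, Multiset.coe_replicate]
    · apply Finset.sum_eq_zero
      intro l hl
      rw [PP, if_neg]
      rintro ⟨hne, hc⟩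
      apply h
      rw [mem_ls] at hl
      cases l with
      | nil => simp at hne
      | cons a l =>
        rw [List.isChain_iff_pairwise, List.pairwise_cons] at hc
        have : a :: l = List.replicate (l.length + 1) a := by
          rw [List.eq_replicate_iff]
          refine ⟨by simp, ?_⟩
          intro b hb
          rcases List.mem_cons.1 hb with h | h
          · exact h
          · exact (hc.1 b h).symm
        refine ⟨a, l.length + 1, by omega, ?_⟩
        rw [hl, this, eq_comm, ← Finsupp.toMultiset_eq_iff, Finsupp.toMultiset_single, Multiset.nsmul_singleton]
        simp [Multiset.coe_replicate]
  rw [h1, MvPowerSeries.coeff_mul]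
  simp only [coeff_DD, one_mul, hP]
  rw [← Finset.sum_filter, Finset.sum_const, nsmul_eq_mul, mul_one]
  rw [← Nat.cast_sum]
  congr 1
  have : ∑ a ∈ m.support, m a = (m.support.sigma fun a => Finset.Icc 1 (m a)).card := by
    simp
  rw [this]
  refine Finset.card_bij (fun x _ => (m - Finsupp.single x.1 x.2, Finsupp.single x.1 x.2)) ?_ ?_ ?_
  · rintro ⟨a, k⟩ h
    simp only [Finset.mem_sigma, Finset.mem_Icc] at h
    simp only [Finset.mem_filter, mem_ad]
    refine ⟨tsub_add_cancel_of_le ?_, a, k, h.2.1, rfl⟩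
    simpa using h.2.2
  · rintro ⟨a, k⟩ h ⟨b, j⟩ h' e
    simp only [Finset.mem_sigma, Finset.mem_Icc] at h h'
    have e2 := (Prod.ext_iff.1 e).2
    simp only at e2
    rw [Finsupp.single_eq_single_iff] at e2
    rcases e2 with ⟨rfl, rfl⟩ | ⟨h1, h2⟩
    · rfl
    · omega
  · rintro ⟨m1, m2⟩ h
    simp only [Finset.mem_filter, mem_ad] at h
    obtain ⟨rfl, a, k, hk, rfl⟩ := h
    refine ⟨⟨a, k⟩, ?_, ?_⟩
    · simp; omega
    · simp

theorem ab_W_eq_V : ab (fun l => (WN l).1) = ab VV := by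
  have hW : ab (fun l => (WN l).1) = ab DD * ab (fun l => (WN l).2) := by rw [W_eq, ab_mul]
  have hN : ab (fun l => (WN l).2) = 1 + ab KK * ab (fun l => (WN l).2) := by
    conv_lhs => rw [N_eq]
    rw [ab_add, ab_II, ← ab_mul]
  have hV : ab (VV : List ℕ → ℤ) = 1 + ab PP * ab VV := by
    conv_lhs => rw [V_eq]
    rw [ab_add, ab_II, ← ab_mul]
  have hK : ab KK + ab DD = ab EE + 1 := by
    rw [← ab_II, ← ab_add, ← ab_add]
    congr 1; funext l; simp only [KK]; ring
  rw [ab_EE] at hK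
  rw [hW]
  linear_combination (ab VV) * hN - ab DD * ab (fun l => (WN l).2) * hV + (ab VV) * ab (fun l => (WN l).2) * hK

def Good {n : ℕ} (w : Fin (n + 1) → ℕ) : Prop :=
  NDDF w ∧ w ⟨n + 1 - 2, by omega⟩ ≤ w ⟨n + 1 - 1, by omega⟩

def GoodA {n : ℕ} (w : Fin (n + 1) → ℕ) : Prop :=
  Good w ∧ ∃ h : 1 < n + 1, w 0 ≤ w ⟨1, h⟩

theorem desF_succ {n : ℕ} (w : Fin (n + 2) → ℕ) :
    desF w = (if w 1 < w 0 then 1 else 0) + desF (fun i : Fin (n + 1) => w i.succ) := by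
  unfold desF
  refine (Fin.card_filter_univ_succ (n := n)
    (fun i : Fin (n + 1) => w ⟨(i : ℕ) + 1, by omega⟩ < w ⟨(i : ℕ), by omega⟩)).trans ?_
  by_cases h : w 1 < w 0
  · rw [if_pos h]
    exact (if_pos h).trans (Nat.add_comm _ _)
  · rw [if_neg h, zero_add]
    exact if_neg h

theorem NDDF_succ {n : ℕ} (w : Fin (n + 2) → ℕ) :
    NDDF w ↔ (∀ h : 2 < n + 2, ¬ (w 1 < w 0 ∧ w ⟨2, h⟩ < w 1)) ∧
      NDDF (fun i : Fin (n + 1) => w i.succ) := by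
  constructor
  · intro H
    refine ⟨fun h => H 0 h, fun i h => H (i + 1) (by omega)⟩
  · rintro ⟨H0, H⟩ i h
    cases i with
    | zero => exact H0 h
    | succ i => exact H i (by omega)

theorem Good_le {n : ℕ} (w : Fin (n + 2) → ℕ) (h : w 0 ≤ w 1) :
    Good w ↔ Good (fun i : Fin (n + 1) => w i.succ) := by
  unfold Good
  rw [NDDF_succ]
  have h0 : ∀ h : 2 < n + 2, ¬ (w 1 < w 0 ∧ w ⟨2, h⟩ < w 1) := by intros; omega
  cases n with
  | zero => simp only [h0]; simpa using fun _ => h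
  | succ n => simp [h0]

theorem Good_lt {n : ℕ} (w : Fin (n + 2) → ℕ) (h : w 1 < w 0) :
    Good w ↔ GoodA (fun i : Fin (n + 1) => w i.succ) := by
  unfold GoodA Good
  rw [NDDF_succ]
  cases n with
  | zero =>
    constructor
    · rintro ⟨_, h3⟩
      exact absurd h3 (not_le.2 h)
    · rintro ⟨_, h3, _⟩
      exact absurd h3 (lt_irrefl _)
  | succ n =>
    simp only [h, true_and, not_lt]
    constructor
    · rintro ⟨⟨h1, h2⟩, h3⟩
      exact ⟨⟨h2, h3⟩, by omega, h1 (by omega)⟩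
    · rintro ⟨⟨h2, h3⟩, _, h1⟩
      exact ⟨⟨fun _ => h1, h2⟩, h3⟩

theorem bridge (n : ℕ) (w : Fin (n + 1) → ℕ) :
    (Good w → 2 * desF w ≤ n ∧ (WN (List.ofFn w)).1 = 2 ^ (n - 2 * desF w)) ∧
    (¬ Good w → (WN (List.ofFn w)).1 = 0) ∧
    (GoodA w → 2 * desF w + 1 ≤ n ∧ (WN (List.ofFn w)).2 = 2 ^ (n - 1 - 2 * desF w)) ∧
    (¬ GoodA w → (WN (List.ofFn w)).2 = 0) := by
  induction n with
  | zero =>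
    have hg : Good w := ⟨fun i h => by omega, le_refl _⟩
    have hd : desF w = 0 := by simp [desF]
    have ha : ¬ GoodA w := by rintro ⟨_, h, _⟩; omega
    simp [hg, hd, ha, WN]
  | succ n ih =>
    obtain ⟨i1, i2, i3, i4⟩ := ih (fun i => w i.succ)
    have hl : WN (List.ofFn w) = if w 0 ≤ w 1 then
        (2 * (WN (List.ofFn fun i : Fin (n + 1) => w i.succ)).1,
          (WN (List.ofFn fun i : Fin (n + 1) => w i.succ)).1) else
        ((WN (List.ofFn fun i : Fin (n + 1) => w i.succ)).2, 0) := by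
      rw [List.ofFn_succ, List.ofFn_succ, WN]; rfl
    rw [hl, desF_succ]
    by_cases h : w 0 ≤ w 1
    · have hA : GoodA w ↔ Good w := ⟨fun x => x.1, fun x => ⟨x, by omega, h⟩⟩
      rw [hA, Good_le w h, if_pos h, if_neg (not_lt.2 h), zero_add]
      refine ⟨fun g => ?_, fun g => ?_, fun g => ?_, fun g => ?_⟩
      · obtain ⟨j1, j2⟩ := i1 g
        refine ⟨by omega, ?_⟩
        rw [j2, ← pow_succ', Nat.sub_add_comm j1]
      · rw [i2 g]; simp
      · obtain ⟨j1, j2⟩ := i1 g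
        exact ⟨by omega, by rw [j2]; simp⟩
      · exact i2 g
    · have hA : ¬ GoodA w := by rintro ⟨_, _, h'⟩; exact h h'
      have h' : w 1 < w 0 := not_le.1 h
      rw [Good_lt w h', if_neg h, if_pos h']
      refine ⟨fun g => ?_, fun g => ?_, fun g => absurd g hA, fun g => rfl⟩
      · obtain ⟨j1, j2⟩ := i3 g
        refine ⟨by omega, ?_⟩
        rw [j2, show n + 1 - 2 * (1 + desF fun i : Fin (n + 1) => w i.succ) =
          n - 1 - 2 * desF fun i : Fin (n + 1) => w i.succ by omega]
      · exact i4 g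

theorem mem_pf (n : ℕ) (w : Fin n → ℕ) : w ∈ pfFinset n ↔
    (∀ i, 1 ≤ w i) ∧ ∀ k ≤ n, k ≤ (Finset.univ.filter fun i => w i ≤ k).card := by
  unfold pfFinset IsParkingFn
  simp only [Finset.mem_filter, Fintype.mem_piFinset, Finset.mem_Icc]
  constructor
  · rintro ⟨_, h1, σ, hm, hs⟩
    refine ⟨h1, fun k hk => ?_⟩
    calc k = ((Finset.univ : Finset (Fin k)).image fun j => σ (Fin.castLE hk j)).card := by
          rw [Finset.card_image_of_injective]
          · simp
          · intro a b hab
            simpa using hab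
      _ ≤ _ := by
          apply Finset.card_le_card
          intro x hx
          simp only [Finset.mem_image, Finset.mem_univ, true_and] at hx
          obtain ⟨j, rfl⟩ := hx
          simp only [Finset.mem_filter, Finset.mem_univ, true_and]
          refine (hs _).trans ?_
          simp
  · rintro ⟨h1, h2⟩
    refine ⟨fun i => ⟨h1 i, ?_⟩, h1, Tuple.sort w, Tuple.monotone_sort w, fun i => ?_⟩
    · have h := h2 n le_rfl
      have : (Finset.univ.filter fun i => w i ≤ n) = Finset.univ := by
        apply Finset.eq_univ_of_card
        apply le_antisymm (Finset.card_le_univ _)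
        simpa using h
      have hi := Finset.mem_univ i
      rw [← this] at hi
      simpa using hi
    · by_contra hc
      push Not at hc
      have h := h2 (i + 1) i.2
      have hsub : (Finset.univ.filter fun j => w j ≤ i + 1) ⊆
          (Finset.univ.filter fun j : Fin n => j < i).image (Tuple.sort w) := by
        intro x hx
        simp only [Finset.mem_filter, Finset.mem_univ, true_and] at hx
        simp only [Finset.mem_image, Finset.mem_filter, Finset.mem_univ, true_and]
        refine ⟨(Tuple.sort w).symm x, ?_, by simp⟩
        by_contra hlt
        have := Tuple.monotone_sort w (not_lt.1 hlt)
        simp only [Function.comp, Equiv.apply_symm_apply] at this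
        omega
      have h3 := (Finset.card_le_card hsub).trans Finset.card_image_le
      have h4 : (Finset.univ.filter fun j : Fin n => j < i).card = i := by
        have e : (Finset.univ.filter fun j : Fin n => j < i) = Finset.Iio i := by ext j; simp
        rw [e, Fin.card_Iio]
      omega

theorem mem_pf' (n : ℕ) (w : Fin n → ℕ) : w ∈ pfFinset n ↔
    (∀ x ∈ (List.ofFn w : Multiset ℕ), 1 ≤ x) ∧
      ∀ k ≤ n, k ≤ (List.ofFn w : Multiset ℕ).countP (fun x => x ≤ k) := by
  rw [mem_pf, ← Fin.univ_val_map]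
  simp only [Multiset.countP_map, Multiset.mem_map]
  simp [Finset.card_def]

theorem sum_pf_s16 (n : ℕ) (f : List ℕ → ℤ) :
    ∑ w ∈ pfFinset n, f (List.ofFn w) =
      ∑ s ∈ (pfFinset n).image (fun w => (List.ofFn w : Multiset ℕ)), ∑ l ∈ lsF s, f l := by
  rw [← Finset.sum_fiberwise_of_maps_to
    (g := fun w : Fin n → ℕ => (List.ofFn w : Multiset ℕ)) (fun w hw => Finset.mem_image_of_mem (fun w : Fin n → ℕ => (List.ofFn w : Multiset ℕ)) hw)]
  refine Finset.sum_congr rfl fun s hs => ?_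
  obtain ⟨w0, hw0, rfl⟩ := Finset.mem_image.1 hs
  refine Finset.sum_bij (fun w _ => List.ofFn w) ?_ ?_ ?_ ?_
  · intro w hw
    rw [mem_lsF, (Finset.mem_filter.1 hw).2]
  · intro w _ w' _ h
    exact List.ofFn_injective h
  · intro l hl
    rw [mem_lsF] at hl
    have hlen : l.length = n := by
      have := congrArg Multiset.card hl
      simpa using this.symm
    subst hlen
    refine ⟨l.get, ?_, List.ofFn_get l⟩
    rw [Finset.mem_filter, mem_pf', List.ofFn_get, ← hl]
    exact ⟨(mem_pf' _ _).1 hw0, rfl⟩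
  · intros; rfl

theorem sum_W_eq_V (n : ℕ) :
    ∑ w ∈ pfFinset n, (WN (List.ofFn w)).1 = ∑ w ∈ pfFinset n, VV (List.ofFn w) := by
  rw [sum_pf_s16 n (fun l => (WN l).1), sum_pf_s16 n VV]
  refine Finset.sum_congr rfl fun s _ => ?_
  have := congrArg (MvPowerSeries.coeff (Multiset.toFinsupp s)) ab_W_eq_V
  simpa [coeff_ab] using this

theorem VV_map {α β : Type} (f : α → β) (hf : Function.Injective f) (l : List α) :
    VV (l.map f) = VV l := by
  induction l with
  | nil => rfl
  | cons a l ih =>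
    cases l with
    | nil => rfl
    | cons b l =>
      simp only [List.map_cons, VV, hf.eq_iff] at ih ⊢
      rw [ih]

theorem sum_VV (α : Type) [Fintype α] (n : ℕ) :
    ∑ u : Fin (n + 1) → α, VV (List.ofFn u) = Fintype.card α * (Fintype.card α + 1) ^ n := by
  induction n with
  | zero => simp [VV]
  | succ n ih =>
    rw [← (Fin.consEquiv (fun _ => α)).sum_comp, Fintype.sum_prod_type_right]
    have : ∀ u : Fin (n + 1) → α, ∑ a : α, VV (List.ofFn (Fin.cons a u : Fin (n + 2) → α)) =
        (Fintype.card α + 1) * VV (List.ofFn u) := by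
      intro u
      have h : ∀ a : α, VV (List.ofFn (Fin.cons a u : Fin (n + 2) → α)) =
          VV (List.ofFn u) + if a = u 0 then VV (List.ofFn u) else 0 := by
        intro a
        rw [List.ofFn_succ]
        simp only [Fin.cons_zero, Fin.cons_succ]
        rw [List.ofFn_succ (f := u), VV]
        split_ifs <;> ring
      simp only [h, Finset.sum_add_distrib]
      simp
      ring
    have h2 : ∀ u : Fin (n + 1) → α, ∑ a : α, VV (List.ofFn (Fin.consEquiv (fun _ : Fin (n + 2) => α) (a, u))) =
        (Fintype.card α + 1) * VV (List.ofFn u) := this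
    simp only [h2]
    rw [← Finset.mul_sum, ih]; ring

def Park {n : ℕ} (u : Fin n → ZMod (n + 1)) : Prop :=
  ∀ k ≤ n, k ≤ (Finset.univ.filter fun i => (u i).val < k).card

noncomputable def ss {n : ℕ} (u : Fin n → ZMod (n + 1)) (k : ℕ) : ℤ :=
  ∑ j ∈ Finset.range k, (((Finset.univ.filter fun i => u i = (j : ZMod (n + 1))).card : ℤ) - 1)

theorem count_rot {n : ℕ} (u : Fin n → ZMod (n + 1)) (r k : ℕ) (hk : k ≤ n + 1) :
    ((Finset.univ.filter fun i => (u i - (r : ZMod (n + 1))).val < k).card : ℤ) =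
      ss u (r + k) - ss u r + k := by
  have h1 : (Finset.univ.filter fun i => (u i - (r : ZMod (n + 1))).val < k).card =
      ∑ j ∈ Finset.range k, (Finset.univ.filter fun i => u i = ((r + j : ℕ) : ZMod (n + 1))).card := by
    rw [Finset.card_eq_sum_card_fiberwise (f := fun i => (u i - (r : ZMod (n + 1))).val)
      (t := Finset.range k)]
    · refine Finset.sum_congr rfl fun j hj => ?_
      congr 1
      ext i
      have hj := Finset.mem_range.1 hj
      simp only [Finset.mem_filter, Finset.mem_univ, true_and]
      constructor
      · rintro ⟨_, h⟩
        rw [← h]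
        push_cast
        rw [ZMod.natCast_zmod_val]; ring
      · intro h
        have : (u i - (r : ZMod (n + 1))).val = j := by
          rw [h]; push_cast
          rw [add_sub_cancel_left, ZMod.val_natCast, Nat.mod_eq_of_lt (by omega)]
        exact ⟨by omega, this⟩
    · intro i hi
      simpa using hi
  rw [h1, ss, ss, Finset.sum_range_add]
  simp

theorem ss_period {n : ℕ} (u : Fin n → ZMod (n + 1)) (r : ℕ) : ss u (r + (n + 1)) = ss u r - 1 := by
  have h := count_rot u r (n + 1) le_rfl
  have h2 : (Finset.univ.filter fun i => (u i - (r : ZMod (n + 1))).val < n + 1) = Finset.univ := by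
    ext i; simpa using ZMod.val_lt (u i - (r : ZMod (n + 1)))
  rw [h2] at h
  simp at h
  linarith

theorem park_iff {n : ℕ} (u : Fin n → ZMod (n + 1)) (r : ℕ) :
    Park (fun i => u i - (r : ZMod (n + 1))) ↔ ∀ k ≤ n, ss u r ≤ ss u (r + k) := by
  unfold Park
  refine forall₂_congr fun k hk => ?_
  have := count_rot u r k (by omega)
  constructor
  · intro h; have h := Int.ofNat_le.2 h; linarith
  · intro h; apply Int.ofNat_le.1; linarith

theorem cycle {n : ℕ} (u : Fin n → ZMod (n + 1)) :
    ∃! r : ZMod (n + 1), Park (fun i => u i - r) := by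
  have hne : ∃ r, r ≤ n ∧ ∀ k ≤ n, ss u r ≤ ss u k := by
    obtain ⟨r, hr, h⟩ := Finset.exists_min_image (Finset.range (n + 1)) (ss u) ⟨0, by simp⟩
    exact ⟨r, by simpa [Nat.lt_succ_iff] using hr, fun k hk => h k (by simp; omega)⟩
  have h0 := Nat.find_spec hne
  have hmin := fun k => Nat.find_min hne (m := k)
  set r := Nat.find hne
  refine ⟨(r : ZMod (n + 1)), ?_, ?_⟩
  · show Park (fun i => u i - (r : ZMod (n + 1)))
    rw [park_iff]
    intro k hk
    by_cases hrk : r + k ≤ n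
    · exact h0.2 _ hrk
    · obtain ⟨j, hj⟩ : ∃ j, r + k = j + (n + 1) := ⟨r + k - (n + 1), by omega⟩
      rw [hj, ss_period]
      have hjr : j < r := by omega
      have := hmin j hjr
      by_contra hc
      apply this
      refine ⟨by omega, fun k hk => ?_⟩
      have := h0.2 k hk
      omega
  · intro y hy
    have hyl := ZMod.val_lt y
    rw [← ZMod.natCast_zmod_val y] at hy ⊢
    set q := y.val
    have hp : ∀ k ≤ n, ss u q ≤ ss u (q + k) := (park_iff u q).1 hy
    congr 1
    have hq0 := h0.2 q (by omega)
    rcases lt_trichotomy q r with h | h | h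
    · exfalso
      have := hp (r - q) (by omega)
      rw [show q + (r - q) = r by omega] at this
      apply hmin q h
      refine ⟨by omega, fun k hk => ?_⟩
      have := h0.2 k hk
      omega
    · exact h
    · exfalso
      have := hp (r + (n + 1) - q) (by omega)
      rw [show q + (r + (n + 1) - q) = r + (n + 1) by omega, ss_period] at this
      omega

theorem sum_park (n : ℕ) :
    ((n : ℤ) + 2) * ∑ u ∈ Finset.univ.filter (Park (n := n + 1)), VV (List.ofFn u) =
      (n + 2) * (n + 3) ^ n := by
  have h1 : ∀ r : ZMod (n + 1 + 1), ∑ u ∈ Finset.univ.filter (Park (n := n + 1)), VV (List.ofFn u) =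
      ∑ u : Fin (n + 1) → ZMod (n + 1 + 1), if Park (fun i => u i - r) then VV (List.ofFn u) else 0 := by
    intro r
    rw [Finset.sum_filter, ← (Equiv.subRight (fun _ : Fin (n + 1) => r)).sum_comp]
    refine Finset.sum_congr rfl fun u _ => ?_
    have e : (Equiv.subRight (fun _ : Fin (n + 1) => r)) u = fun i => u i - r := by
      funext i; simp
    rw [e]
    have : List.ofFn (fun i => u i - r) = (List.ofFn u).map (fun x => x - r) := by
      rw [List.map_ofFn]; rfl
    rw [this, VV_map _ (fun a b h => by simpa using h)]
  have h2 := sum_VV (ZMod (n + 1 + 1)) n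
  rw [ZMod.card] at h2
  calc ((n : ℤ) + 2) * ∑ u ∈ Finset.univ.filter (Park (n := n + 1)), VV (List.ofFn u)
      = ∑ r : ZMod (n + 1 + 1), ∑ u ∈ Finset.univ.filter (Park (n := n + 1)), VV (List.ofFn u) := by
        rw [Finset.sum_const, Finset.card_univ, ZMod.card, nsmul_eq_mul]
        push_cast; ring
    _ = ∑ r : ZMod (n + 1 + 1), ∑ u : Fin (n + 1) → ZMod (n + 1 + 1),
          if Park (fun i => u i - r) then VV (List.ofFn u) else 0 :=
        Finset.sum_congr rfl fun r _ => h1 r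
    _ = ∑ u : Fin (n + 1) → ZMod (n + 1 + 1), VV (List.ofFn u) := by
        rw [Finset.sum_comm]
        refine Finset.sum_congr rfl fun u _ => ?_
        obtain ⟨r, hr, hu⟩ := cycle u
        rw [Finset.sum_eq_single r]
        · exact if_pos hr
        · intro b _ hb
          exact if_neg fun h => hb (hu b h)
        · simp
    _ = _ := by rw [h2]; push_cast; ring

theorem sum_pf_VV (n : ℕ) :
    ∑ w ∈ pfFinset n, VV (List.ofFn w) =
      ∑ u ∈ Finset.univ.filter (Park (n := n)), VV (List.ofFn u) := by
  symm
  have hinj : Function.Injective (fun x : ZMod (n + 1) => x.val + 1) := by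
    intro a b h
    simp only [Nat.add_right_cancel_iff] at h
    exact ZMod.val_injective _ h
  refine Finset.sum_bij (fun u _ => fun i => (u i).val + 1) ?_ ?_ ?_ ?_
  · intro u hu
    rw [mem_pf]
    refine ⟨fun i => by omega, fun k hk => ?_⟩
    exact (Finset.mem_filter.1 hu).2 k hk
  · intro u _ u' _ h
    funext i
    exact hinj (congrFun h i)
  · intro w hw
    have hb : ∀ i, w i ≤ n := by
      intro i
      have := (Fintype.mem_piFinset.1 (Finset.mem_filter.1 hw).1) i
      exact (Finset.mem_Icc.1 this).2
    rw [mem_pf] at hw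
    have hv : ∀ i, ((w i - 1 : ℕ) : ZMod (n + 1)).val + 1 = w i := by
      intro i
      have := hw.1 i
      have := hb i
      rw [ZMod.val_natCast, Nat.mod_eq_of_lt (by omega)]; omega
    refine ⟨fun i => ((w i - 1 : ℕ) : ZMod (n + 1)), ?_, ?_⟩
    · rw [Finset.mem_filter]
      refine ⟨Finset.mem_univ _, fun k hk => ?_⟩
      have := hw.2 k hk
      convert this using 4 with i
      have := hv i
      show ((w i - 1 : ℕ) : ZMod (n + 1)).val < k ↔ _
      omega
    · funext i
      exact hv i
  · intro u _
    rw [← VV_map _ hinj (List.ofFn u), List.map_ofFn]; rfl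

theorem main_sum (n : ℕ) :
    ∑ w ∈ pfFinset (n + 1), (WN (List.ofFn w)).1 = ((n : ℤ) + 3) ^ n := by
  rw [sum_W_eq_V, sum_pf_VV]
  have := sum_park n
  exact mul_left_cancel₀ (by positivity) this

/-- Corollary 8.2 of Linusson–Shareshian–Wachs, the `t = 1` case:
for `n ≥ 1`, the sum of `2^{n-1-2 des w}` over all parking functions `w` of length `n`
with no double descent satisfying `w_{n-1} ≤ w_n` (vacuous for `n = 1`) equals
`(n+2)^{n-1}`. -/
theorem statement_16 (n : ℕ) (hn : 1 ≤ n) :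
    (∑ w ∈ (pfFinset n).filter
        (fun w => NDDF w ∧ w ⟨n - 2, by omega⟩ ≤ w ⟨n - 1, by omega⟩),
      2 ^ (n - 1 - 2 * desF w)) = (n + 2) ^ (n - 1) := by

  obtain ⟨n, rfl⟩ : ∃ k, n = k + 1 := ⟨n - 1, by omega⟩
  have h := main_sum n
  have h2 : ∀ w : Fin (n + 1) → ℕ, (WN (List.ofFn w)).1 =
      if NDDF w ∧ w ⟨n + 1 - 2, by omega⟩ ≤ w ⟨n + 1 - 1, by omega⟩
        then ((2 ^ (n + 1 - 1 - 2 * desF w) : ℕ) : ℤ) else 0 := by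
    intro w
    obtain ⟨b1, b2, _⟩ := bridge n w
    split_ifs with hg
    · rw [(b1 hg).2]; push_cast; rfl
    · exact b2 hg
  simp only [h2] at h
  rw [← Finset.sum_filter, ← Nat.cast_sum] at h
  have h3 : (((n + 1 + 2) ^ (n + 1 - 1) : ℕ) : ℤ) = ((n : ℤ) + 3) ^ n := by
    push_cast
    congr 1
  rw [← h3] at h
  exact_mod_cast h
end
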